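/- arXiv:2512.23134 — 9 statements merged into one kernel-verified Lean document; each statement's English description precedes it below -/
import Mathlib

section
/- Let α ∈ (0,1) and let x ∈ ℝ^n be a nonzero vector, and set x_min = min_{1≤j≤n} |x_j|. Then (n − α√n)·x_min + (1−α)(‖x‖₁ − n·x_min) ≤ ‖x‖₁ − α‖x‖₂ ≤ (√n − α)‖x‖₂. -/
/-- The ℓ¹-norm of a vector in ℝ^n. -/
noncomputable def norm1 {n : ℕ} (x : Fin n → ℝ) : ℝ := ∑ i, |x i|

/-- The Euclidean (ℓ²) norm of a vector in ℝ^n. -/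
noncomputable def norm2 {n : ℕ} (x : Fin n → ℝ) : ℝ := Real.sqrt (∑ i, (x i) ^ 2)

/-- Triangle inequality for `x = m • 1 + (x - m • 1)`, bounding `ℓ²` by `ℓ¹` on the second part. -/
theorem norm2_le_sqrt_mul_add {n : ℕ} (hn : 1 ≤ n) (x : Fin n → ℝ) {m : ℝ} (hm : 0 ≤ m)
    (hle : ∀ i, m ≤ |x i|) :
    norm2 x ≤ Real.sqrt n * m + (norm1 x - n * m) := by
  have hsum : ∑ i, (|x i| - m) = norm1 x - n * m := by
    simp [norm1, Finset.sum_sub_distrib]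
  have hnonneg : ∀ i ∈ Finset.univ, 0 ≤ |x i| - m := fun i _ => sub_nonneg.2 (hle i)
  have hT : 0 ≤ norm1 x - n * m := hsum ▸ Finset.sum_nonneg hnonneg
  have hsq : ∑ i, (|x i| - m) ^ 2 ≤ (norm1 x - n * m) ^ 2 :=
    hsum ▸ Finset.sum_sq_le_sq_sum_of_nonneg hnonneg
  have hexpand : ∑ i, x i ^ 2 =
      ∑ i, (|x i| - m) ^ 2 + 2 * m * (norm1 x - n * m) + n * m ^ 2 := by
    rw [← hsum, Finset.mul_sum, ← Finset.sum_add_distrib]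
    have hconst : (n : ℝ) * m ^ 2 = ∑ _i : Fin n, m ^ 2 := by simp
    rw [hconst, ← Finset.sum_add_distrib]
    refine Finset.sum_congr rfl fun i _ => ?_
    rw [← sq_abs (x i)]
    ring
  have hsqrt : 1 ≤ Real.sqrt n := Real.one_le_sqrt.2 (by exact_mod_cast hn)
  have hn_sq : Real.sqrt n ^ 2 = n := Real.sq_sqrt n.cast_nonneg
  refine Real.sqrt_le_iff.2 ⟨by positivity, ?_⟩
  have hcross := mul_nonneg (sub_nonneg.2 hsqrt) (mul_nonneg hm hT)
  calc ∑ i, x i ^ 2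
      ≤ (norm1 x - n * m) ^ 2 + 2 * m * (norm1 x - n * m) + Real.sqrt n ^ 2 * m ^ 2 := by
        rw [hexpand, hn_sq]
        gcongr
    _ ≤ (Real.sqrt n * m + (norm1 x - n * m)) ^ 2 := by linarith

theorem norm1_le_sqrt_mul_norm2 {n : ℕ} (x : Fin n → ℝ) :
    norm1 x ≤ Real.sqrt n * norm2 x := by
  rw [norm2, ← Real.sqrt_mul n.cast_nonneg]
  refine Real.le_sqrt_of_sq_le ?_
  simpa [norm1] using sq_sum_le_card_mul_sum_sq (s := Finset.univ) (f := fun i => |x i|)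

/-- For α ∈ (0,1) and nonzero x ∈ ℝ^n with x_min = min_j |x_j|,
  (n − α√n)·x_min + (1−α)(‖x‖₁ − n·x_min) ≤ ‖x‖₁ − α‖x‖₂ ≤ (√n − α)‖x‖₂. -/
theorem stmt0 {n : ℕ} (α : ℝ) (hα : 0 < α) (hα1 : α < 1)
    (x : Fin n → ℝ) (hx : x ≠ 0)
    (xmin : ℝ) (hxmin : IsLeast (Set.range fun j => |x j|) xmin) :
    ((n : ℝ) - α * Real.sqrt n) * xmin + (1 - α) * (norm1 x - n * xmin)
      ≤ norm1 x - α * norm2 x ∧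
    norm1 x - α * norm2 x ≤ (Real.sqrt n - α) * norm2 x := by
  obtain ⟨⟨j, hj⟩, hlb⟩ := hxmin
  have hm : 0 ≤ xmin := hj ▸ abs_nonneg (x j)
  have hlower := norm2_le_sqrt_mul_add (Fin.pos j) x hm fun i => hlb ⟨i, rfl⟩
  constructor
  · linarith [mul_le_mul_of_nonneg_left hlower hα.le]
  · linarith [norm1_le_sqrt_mul_norm2 x]
end

section
/- Let α ∈ (0,1) and let x ∈ ℝ^n be a nonzero vector with support Λ = supp(x) of cardinality s = ‖x‖₀, and set x_min = min_{j∈Λ} |x_j|. Then (s − α√s)·x_min + (1−α)(‖x_Λ‖₁ − s·x_min) ≤ ‖x_Λ‖₁ − α‖x_Λ‖₂ ≤ (√s − α)‖x‖₂. -/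
/-- If all `a i` are at least `m ≥ 0`, splitting `a = m + (a - m)` bounds the ℓ²-norm of `a`. -/
theorem sqrt_sum_sq_le_sqrt_card_mul_add {ι : Type*} (t : Finset ι) (a : ι → ℝ) {m : ℝ}
    (hm : 0 ≤ m) (ha : ∀ i ∈ t, m ≤ a i) :
    Real.sqrt (∑ i ∈ t, a i ^ 2) ≤ Real.sqrt t.card * m + (∑ i ∈ t, a i - t.card * m) := by
  rcases t.eq_empty_or_nonempty with rfl | ht
  · simp
  have hd : ∀ i ∈ t, 0 ≤ a i - m := fun i hi => sub_nonneg.2 (ha i hi)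
  have hD : ∑ i ∈ t, (a i - m) = ∑ i ∈ t, a i - t.card * m := by
    simp [Finset.sum_sub_distrib]
  have hD0 : 0 ≤ ∑ i ∈ t, (a i - m) := Finset.sum_nonneg hd
  have hsq : ∑ i ∈ t, (a i - m) ^ 2 ≤ (∑ i ∈ t, (a i - m)) ^ 2 :=
    Finset.sum_sq_le_sq_sum_of_nonneg hd
  have hexp : ∑ i ∈ t, a i ^ 2
      = t.card * m ^ 2 + 2 * m * ∑ i ∈ t, (a i - m) + ∑ i ∈ t, (a i - m) ^ 2 := by
    rw [Finset.mul_sum, ← nsmul_eq_mul, ← Finset.sum_const, ← Finset.sum_add_distrib,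
      ← Finset.sum_add_distrib]
    exact Finset.sum_congr rfl fun i _ => by ring
  have hone : 1 ≤ Real.sqrt t.card :=
    Real.one_le_sqrt.2 (by exact_mod_cast ht.card_pos)
  have hcard : Real.sqrt t.card ^ 2 = t.card := Real.sq_sqrt (Nat.cast_nonneg _)
  rw [← hD]
  refine Real.sqrt_le_iff.2 ⟨by positivity, ?_⟩
  have hcross := mul_le_mul_of_nonneg_right hone (mul_nonneg hm hD0)
  rw [hexp, add_sq, mul_pow, hcard]
  linarith

theorem sum_le_sqrt_card_mul_sqrt_sum_sq {ι : Type*} (t : Finset ι) (a : ι → ℝ) :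
    ∑ i ∈ t, a i ≤ Real.sqrt t.card * Real.sqrt (∑ i ∈ t, a i ^ 2) := by
  rw [← Real.sqrt_mul (Nat.cast_nonneg _)]
  exact Real.le_sqrt_of_sq_le sq_sum_le_card_mul_sum_sq

/-- For α ∈ (0,1), nonzero x ∈ ℝ^n with support Λ of cardinality s and
  x_min = min_{j∈Λ} |x_j|, and x_Λ the restriction of x to Λ,
  (s − α√s)·x_min + (1−α)(‖x_Λ‖₁ − s·x_min) ≤ ‖x_Λ‖₁ − α‖x_Λ‖₂ ≤ (√s − α)‖x‖₂. -/
theorem stmt1 {n : ℕ} (α : ℝ) (hα : 0 < α) (hα1 : α < 1)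
    (x : Fin n → ℝ) (hx : x ≠ 0)
    (Λ : Finset (Fin n)) (hΛ : Λ = Finset.univ.filter (fun i => x i ≠ 0))
    (s : ℕ) (hs : s = Λ.card)
    (xmin : ℝ) (hxmin : IsLeast ((fun j => |x j|) '' (Λ : Set (Fin n))) xmin)
    (xΛ : Fin n → ℝ) (hxΛ : xΛ = fun i => if i ∈ Λ then x i else 0) :
    ((s : ℝ) - α * Real.sqrt s) * xmin + (1 - α) * (norm1 xΛ - s * xmin)
      ≤ norm1 xΛ - α * norm2 xΛ ∧
    norm1 xΛ - α * norm2 xΛ ≤ (Real.sqrt s - α) * norm2 x := by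
  have hmem : ∀ i, i ∈ Λ ↔ x i ≠ 0 := by simp [hΛ]
  have hx_eq : xΛ = x := by
    ext i
    by_cases h : x i = 0 <;> simp [hxΛ, hmem, h]
  have h1 : norm1 x = ∑ i ∈ Λ, |x i| :=
    (Finset.sum_subset (Finset.subset_univ Λ) fun i _ hi => by
      simpa [hmem] using hi).symm
  have h2 : norm2 x = Real.sqrt (∑ i ∈ Λ, |x i| ^ 2) := by
    simp only [norm2, sq_abs]
    congr 1
    exact (Finset.sum_subset (Finset.subset_univ Λ) fun i _ hi => by
      simpa [hmem] using hi).symm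
  have hm : 0 ≤ xmin := by
    obtain ⟨j, -, rfl⟩ := hxmin.1
    exact abs_nonneg _
  have hlow := sqrt_sum_sq_le_sqrt_card_mul_add Λ (fun i => |x i|) hm
    fun i hi => hxmin.2 ⟨i, hi, rfl⟩
  have hupp := sum_le_sqrt_card_mul_sqrt_sum_sq Λ fun i => |x i|
  rw [← h1, ← h2, ← hs] at hlow hupp
  rw [hx_eq]
  constructor
  · linarith [mul_le_mul_of_nonneg_left hlow hα.le]
  · linarith
end

section
/- Let α ∈ (0,1) and let x ∈ ℝ^n be a nonzero vector whose entries, reordered so that |x_1| ≥ |x_2| ≥ ⋯ ≥ |x_n|, satisfy |x_i| ≥ C·i^{−p}·x_min for all i ∈ {1,…,n}, where x_min = min_j |x_j|, C ≥ 1 and p ≥ 0. Then C·x_min·( α·n^{1/2−p}(n^{1/2} − 1) + (1−α)·H_{n,p} ) ≤ ‖x‖₁ − α‖x‖₂. -/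
/-- If every entry of `x` has absolute value at least `t ≥ 0`, then
`(n - √n) t ≤ ‖x‖₁ - ‖x‖₂`. -/
theorem mul_le_norm1_sub_norm2 {n : ℕ} (hn : 1 ≤ n) (x : Fin n → ℝ) {t : ℝ} (ht : 0 ≤ t)
    (h : ∀ i, t ≤ |x i|) : ((n : ℝ) - √n) * t ≤ norm1 x - norm2 x := by
  have hs : 1 ≤ √(n : ℝ) := Real.one_le_sqrt.2 (by exact_mod_cast hn)
  have hss : √(n : ℝ) * √n = n := Real.mul_self_sqrt n.cast_nonneg
  set Y := ∑ i, (|x i| - t) with hY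
  have hY0 : 0 ≤ Y := Finset.sum_nonneg fun i _ => sub_nonneg.2 (h i)
  have hYx : norm1 x = Y + n * t := by simp [hY, norm1, Finset.sum_sub_distrib]
  have hYsq : ∑ i, (|x i| - t) ^ 2 ≤ Y ^ 2 :=
    Finset.sum_sq_le_sq_sum_of_nonneg fun i _ => sub_nonneg.2 (h i)
  have hexp : ∑ i, x i ^ 2 = ∑ i, (|x i| - t) ^ 2 + 2 * t * Y + n * t ^ 2 := by
    have hpt : ∀ i, x i ^ 2 = (|x i| - t) ^ 2 + 2 * t * (|x i| - t) + t ^ 2 := fun i => by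
      rw [← sq_abs]; ring
    simp_rw [hpt, Finset.sum_add_distrib, ← Finset.mul_sum]
    simp [hY]
  have h2 : norm2 x ≤ Y + t * √n := by
    refine Real.sqrt_le_iff.2 ⟨by positivity, ?_⟩
    have hcross : 0 ≤ t * Y * (√(n : ℝ) - 1) := by
      have := sub_nonneg.2 hs
      positivity
    linear_combination hexp + hYsq + 2 * hcross - t ^ 2 * hss
  linarith

/-- For α ∈ (0,1), C ≥ 1, p ≥ 0, and nonzero x ∈ ℝ^n whose entries reordered
  decreasingly in absolute value (via a permutation σ) satisfy |x_{σ(i)}| ≥ C·i^{−p}·x_min,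
  where x_min = min_j |x_j|, one has
  C·x_min·(α·n^{1/2−p}(n^{1/2} − 1) + (1−α)·H_{n,p}) ≤ ‖x‖₁ − α‖x‖₂,
  where H_{n,p} = ∑_{i=1}^n i^{−p}. -/
theorem stmt2 {n : ℕ} (α C p : ℝ) (hα : 0 < α) (hα1 : α < 1) (hC : 1 ≤ C) (hp : 0 ≤ p)
    (x : Fin n → ℝ) (hx : x ≠ 0)
    (xmin : ℝ) (hxmin : IsLeast (Set.range fun j => |x j|) xmin)
    (σ : Equiv.Perm (Fin n))
    (hsort : ∀ i j : Fin n, i ≤ j → |x (σ j)| ≤ |x (σ i)|)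
    (hbound : ∀ i : Fin n, C * (((i : ℕ) : ℝ) + 1) ^ (-p) * xmin ≤ |x (σ i)|) :
    C * xmin * (α * (n : ℝ) ^ ((1 : ℝ) / 2 - p) * ((n : ℝ) ^ ((1 : ℝ) / 2) - 1)
        + (1 - α) * ∑ i : Fin n, (((i : ℕ) : ℝ) + 1) ^ (-p))
      ≤ norm1 x - α * norm2 x := by
  obtain ⟨⟨k, hk⟩, hmin⟩ := hxmin
  have hn : 1 ≤ n := k.pos
  have hn0 : (0 : ℝ) < n := by exact_mod_cast hn
  have hm : 0 ≤ xmin := hk ▸ abs_nonneg (x k)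
  have hC0 : 0 ≤ C := by linarith
  have ht : C * (n : ℝ) ^ (-p) * xmin ≤ xmin := by
    have hb := hbound (σ.symm k)
    simp only [Equiv.apply_symm_apply, hk] at hb
    refine le_trans ?_ hb
    have hle : (((σ.symm k : Fin n) : ℕ) : ℝ) + 1 ≤ n := by exact_mod_cast (σ.symm k).isLt
    have := Real.rpow_le_rpow_of_nonpos (by positivity) hle (neg_nonpos.2 hp)
    gcongr
  have hdiff : ((n : ℝ) - √n) * (C * (n : ℝ) ^ (-p) * xmin) ≤ norm1 x - norm2 x :=
    mul_le_norm1_sub_norm2 hn x (by positivity) fun i => ht.trans (hmin ⟨i, rfl⟩)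
  have hsum : C * xmin * ∑ i : Fin n, (((i : ℕ) : ℝ) + 1) ^ (-p) ≤ norm1 x := by
    rw [norm1, ← Equiv.sum_comp σ fun i => |x i|, Finset.mul_sum]
    refine Finset.sum_le_sum fun i _ => le_trans (le_of_eq ?_) (hbound i)
    ring
  have hpow : (n : ℝ) ^ ((1 : ℝ) / 2 - p) * ((n : ℝ) ^ ((1 : ℝ) / 2) - 1)
      = ((n : ℝ) - √n) * (n : ℝ) ^ (-p) := by
    rw [sub_eq_add_neg ((1 : ℝ) / 2) p, Real.rpow_add hn0, ← Real.sqrt_eq_rpow]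
    linear_combination (n : ℝ) ^ (-p) * Real.mul_self_sqrt hn0.le
  rw [mul_assoc α, hpow]
  linear_combination α * hdiff + (1 - α) * hsum
end

section
/- Let α ∈ (0,1), γ ∈ (0,1), p ≥ 0, and let x ∈ ℝ^n be a nonzero vector whose entries, reordered so that |x_1| ≥ |x_2| ≥ ⋯ ≥ |x_n|, satisfy |x_i| ≥ n^p·i^{−p}·x_min for all i ∈ {1,…,n}, where x_min = min_j |x_j|. Then γ(α·n − α√n + (1−α)·n^p·H_{n,p})·x_min + (1−γ)‖x‖₂² ≤ f_{α,γ}(x) ≤ γ(√n − α)‖x‖₂ + (1−γ)‖x‖₂². -/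
/-- The DCEN measure f_{α,γ}(x) = γ(‖x‖₁ − α‖x‖₂) + (1−γ)‖x‖₂². -/
noncomputable def fag {n : ℕ} (α γ : ℝ) (x : Fin n → ℝ) : ℝ :=
  γ * (norm1 x - α * norm2 x) + (1 - γ) * (norm2 x) ^ 2

theorem norm2_add_le_norm1 {n : ℕ} (hn : 1 ≤ n) (x : Fin n → ℝ) {m : ℝ} (hm : 0 ≤ m)
    (h : ∀ i, m ≤ |x i|) :
    norm2 x + (n - Real.sqrt n) * m ≤ norm1 x := by
  have hS : 0 ≤ ∑ i, (|x i| - m) := Finset.sum_nonneg fun i _ => sub_nonneg.2 (h i)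
  have hsq : ∑ i, (|x i| - m) ^ 2 ≤ (∑ i, (|x i| - m)) ^ 2 :=
    Finset.sum_sq_le_sq_sum_of_nonneg fun i _ => sub_nonneg.2 (h i)
  have hsum : ∑ i, (|x i| - m) = norm1 x - n * m := by
    simp [norm1, Finset.sum_sub_distrib]
  have hexp : ∑ i, x i ^ 2 =
      ∑ i, (|x i| - m) ^ 2 + 2 * m * ∑ i, (|x i| - m) + n * m ^ 2 := by
    have hconst : (n : ℝ) * m ^ 2 = ∑ _i : Fin n, m ^ 2 := by simp
    rw [hconst, Finset.mul_sum, ← Finset.sum_add_distrib, ← Finset.sum_add_distrib]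
    refine Finset.sum_congr rfl fun i _ => ?_
    rw [← sq_abs (x i)]
    ring
  have hroot : 1 ≤ Real.sqrt n := Real.one_le_sqrt.2 (by exact_mod_cast hn)
  have hnn : Real.sqrt n ^ 2 = n := Real.sq_sqrt (Nat.cast_nonneg n)
  have key : norm2 x ≤ ∑ i, (|x i| - m) + Real.sqrt n * m := by
    refine Real.sqrt_le_iff.2 ⟨by positivity, ?_⟩
    rw [hexp, add_sq, mul_pow, hnn]
    nlinarith [mul_nonneg (mul_nonneg hm hS) (sub_nonneg.2 hroot)]
  rw [hsum] at key
  linarith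

/-- For α, γ ∈ (0,1), p ≥ 0, and nonzero x ∈ ℝ^n whose entries reordered
  decreasingly in absolute value (via a permutation σ) satisfy |x_{σ(i)}| ≥ n^p·i^{−p}·x_min,
  where x_min = min_j |x_j|,
  γ(α·n − α√n + (1−α)·n^p·H_{n,p})·x_min + (1−γ)‖x‖₂² ≤ f_{α,γ}(x)
    ≤ γ(√n − α)‖x‖₂ + (1−γ)‖x‖₂². -/
theorem stmt3 {n : ℕ} (α γ p : ℝ) (hα : 0 < α) (hα1 : α < 1)
    (hγ : 0 < γ) (hγ1 : γ < 1) (hp : 0 ≤ p)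
    (x : Fin n → ℝ) (hx : x ≠ 0)
    (xmin : ℝ) (hxmin : IsLeast (Set.range fun j => |x j|) xmin)
    (σ : Equiv.Perm (Fin n))
    (hsort : ∀ i j : Fin n, i ≤ j → |x (σ j)| ≤ |x (σ i)|)
    (hbound : ∀ i : Fin n, (n : ℝ) ^ p * (((i : ℕ) : ℝ) + 1) ^ (-p) * xmin ≤ |x (σ i)|) :
    γ * (α * n - α * Real.sqrt n
        + (1 - α) * (n : ℝ) ^ p * ∑ i : Fin n, (((i : ℕ) : ℝ) + 1) ^ (-p)) * xmin
      + (1 - γ) * (norm2 x) ^ 2 ≤ fag α γ x ∧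
    fag α γ x ≤ γ * (Real.sqrt n - α) * norm2 x + (1 - γ) * (norm2 x) ^ 2 := by
  have hn : 1 ≤ n := by
    obtain ⟨j, -⟩ := hxmin.1
    exact j.pos
  have hmin : ∀ i, xmin ≤ |x i| := fun i => hxmin.2 ⟨i, rfl⟩
  have hm : 0 ≤ xmin := by
    obtain ⟨j, rfl⟩ := hxmin.1
    exact abs_nonneg _
  have hdiff := norm2_add_le_norm1 hn x hm hmin
  have hharm : (n : ℝ) ^ p * (∑ i : Fin n, (((i : ℕ) : ℝ) + 1) ^ (-p)) * xmin ≤ norm1 x := by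
    rw [norm1, ← Equiv.sum_comp σ fun i => |x i|, Finset.mul_sum, Finset.sum_mul]
    exact Finset.sum_le_sum fun i _ => hbound i
  have hupper := norm1_le_sqrt_mul_norm2 x
  unfold fag
  constructor
  · have hα' := mul_le_mul_of_nonneg_left hdiff hα.le
    have hα1' := mul_le_mul_of_nonneg_left hharm (sub_nonneg.2 hα1.le)
    rw [mul_assoc γ]
    gcongr
    linarith
  · rw [mul_assoc γ]
    gcongr
    linarith
end

section
/- Let α ∈ (0,1), γ ∈ (0,1), r > 0, and let x ∈ ℝ^n be a nonzero vector with ‖x‖₂ = r. Then f_{α,γ}(x) > 0, and f_{α,γ}(x) ≥ γ(1−α)r + (1−γ)r², where the lower bound γ(1−α)r + (1−γ)r² is exactly the value of f_{α,γ} at any 1-sparse vector z (a vector with exactly one nonzero entry) with ‖z‖₂ = r; i.e., among vectors of Euclidean norm r, f_{α,γ} attains its minimum at 1-sparse vectors. -/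
/-- The Euclidean norm is bounded by the ℓ¹-norm. -/
theorem norm2_le_norm1 {n : ℕ} (x : Fin n → ℝ) : norm2 x ≤ norm1 x := by
  unfold norm2 norm1
  refine Real.sqrt_le_iff.mpr ⟨Finset.sum_nonneg fun i _ => abs_nonneg (x i), ?_⟩
  simpa only [sq_abs] using
    Finset.sum_sq_le_sq_sum_of_nonneg (s := Finset.univ) fun i _ => abs_nonneg (x i)

/-- The Euclidean norm and the ℓ¹-norm agree on vectors supported on a single coordinate. -/
theorem norm1_eq_norm2_of_forall_ne {n : ℕ} {z : Fin n → ℝ} {i : Fin n}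
    (h : ∀ j, j ≠ i → z j = 0) : norm1 z = norm2 z := by
  unfold norm1 norm2
  rw [Fintype.sum_eq_single i fun j hj => by simp [h j hj],
    Fintype.sum_eq_single i fun j hj => by simp [h j hj], Real.sqrt_sq_eq_abs]

/-- For α, γ ∈ (0,1), r > 0, and nonzero x ∈ ℝ^n with ‖x‖₂ = r, one has
  f_{α,γ}(x) > 0 and f_{α,γ}(x) ≥ γ(1−α)r + (1−γ)r², and this lower bound is exactly the
  value of f_{α,γ} at any 1-sparse vector z with ‖z‖₂ = r. -/
theorem stmt5 {n : ℕ} (α γ r : ℝ) (hα : 0 < α) (hα1 : α < 1)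
    (hγ : 0 < γ) (hγ1 : γ < 1) (hr : 0 < r)
    (x : Fin n → ℝ) (hx : x ≠ 0) (hxr : norm2 x = r) :
    0 < fag α γ x ∧
    γ * (1 - α) * r + (1 - γ) * r ^ 2 ≤ fag α γ x ∧
    ∀ z : Fin n → ℝ, (∃! i, z i ≠ 0) → norm2 z = r →
      fag α γ z = γ * (1 - α) * r + (1 - γ) * r ^ 2 := by
  have lower : γ * (1 - α) * r + (1 - γ) * r ^ 2 ≤ fag α γ x := by
    have h := mul_le_mul_of_nonneg_left (norm2_le_norm1 x) hγ.le
    unfold fag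
    rw [hxr] at h ⊢
    linarith
  refine ⟨lt_of_lt_of_le ?_ lower, lower, ?_⟩
  · have := sub_pos.mpr hα1
    have := sub_pos.mpr hγ1
    positivity
  · rintro z ⟨i, -, hi⟩ hz
    have h : norm1 z = norm2 z :=
      norm1_eq_norm2_of_forall_ne fun j hj => by_contra fun hne => hj (hi j hne)
    unfold fag
    rw [h, hz]
    ring
end

section
/- Let α ∈ (0,1), γ ∈ (0,1), A ∈ ℝ^{m×n}, b ∈ ℝ^m, and let x* ∈ ℝ^n satisfy A x* = b. Set r = ‖x*‖₂, Λ* = supp(x*), and κ(r) = γ(1−α) / (γ(1+α) + 2(1−γ)r) ∈ (0,1). If there exists a constant κ ∈ (0, κ(r)) such that for every nonzero h ∈ ker(A) one has ‖h_{Λ*}‖₁ < κ·‖h_{Λ*ᶜ}‖₁, then x* is the unique minimizer of γ(‖x‖₁ − α‖x‖₂) + (1−γ)‖x‖₂² over {x ∈ ℝ^n : Ax = b}. -/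
theorem norm2_nonneg {n : ℕ} (x : Fin n → ℝ) : 0 ≤ norm2 x := Real.sqrt_nonneg _

theorem norm2_sq {n : ℕ} (x : Fin n → ℝ) : norm2 x ^ 2 = ∑ i, x i ^ 2 :=
  Real.sq_sqrt (Finset.sum_nonneg fun _ _ => sq_nonneg _)

theorem norm1_nonneg {n : ℕ} (x : Fin n → ℝ) : 0 ≤ norm1 x :=
  Finset.sum_nonneg fun _ _ => abs_nonneg _

theorem abs_apply_le_norm2 {n : ℕ} (x : Fin n → ℝ) (i : Fin n) : |x i| ≤ norm2 x :=
  Real.abs_le_sqrt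
    (Finset.single_le_sum (f := fun j => x j ^ 2) (fun _ _ => sq_nonneg _) (Finset.mem_univ i))

theorem norm1_restrict_add_compl {n : ℕ} (s : Finset (Fin n)) (h : Fin n → ℝ) :
    norm1 (fun i => if i ∈ s then h i else 0) + norm1 (fun i => if i ∉ s then h i else 0) =
      norm1 h := by
  simp only [norm1, ← Finset.sum_add_distrib]
  refine Finset.sum_congr rfl fun i _ => ?_
  by_cases hi : i ∈ s <;> simp [hi]

theorem sum_sq_le_norm1_sq {n : ℕ} (h : Fin n → ℝ) : ∑ i, h i ^ 2 ≤ norm1 h ^ 2 := by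
  simpa only [norm1, sq_abs] using
    Finset.sum_sq_le_sq_sum_of_nonneg (s := Finset.univ) (f := fun i => |h i|)
      fun i _ => abs_nonneg (h i)

theorem abs_sum_mul_le_norm2_mul_norm1_restrict {n : ℕ} (s : Finset (Fin n)) (x h : Fin n → ℝ)
    (hx : ∀ i, i ∉ s → x i = 0) :
    |∑ i, x i * h i| ≤ norm2 x * norm1 (fun i => if i ∈ s then h i else 0) := by
  rw [norm1, Finset.mul_sum]
  refine (Finset.abs_sum_le_sum_abs _ _).trans (Finset.sum_le_sum fun i _ => ?_)
  by_cases hi : i ∈ s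
  · simpa [hi, abs_mul] using
      mul_le_mul_of_nonneg_right (abs_apply_le_norm2 x i) (abs_nonneg (h i))
  · simp [hi, hx i hi]

theorem norm1_add_ge {n : ℕ} (s : Finset (Fin n)) (x h : Fin n → ℝ)
    (hx : ∀ i, i ∉ s → x i = 0) :
    norm1 x - norm1 (fun i => if i ∈ s then h i else 0)
      + norm1 (fun i => if i ∉ s then h i else 0) ≤ norm1 (x + h) := by
  simp only [norm1, ← Finset.sum_add_distrib, ← Finset.sum_sub_distrib]
  refine Finset.sum_le_sum fun i _ => ?_
  by_cases hi : i ∈ s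
  · have := abs_sub_abs_le_abs_sub (x i) (-h i)
    simpa [hi] using this
  · simp [hi, hx i hi]

theorem norm2_add_sq {n : ℕ} (x h : Fin n → ℝ) :
    norm2 (x + h) ^ 2 = norm2 x ^ 2 + 2 * ∑ i, x i * h i + ∑ i, h i ^ 2 := by
  simp only [norm2_sq, Finset.mul_sum, ← Finset.sum_add_distrib, Pi.add_apply]
  exact Finset.sum_congr rfl fun i _ => by ring

/-- Under the DCEN stable null space property with constant
  κ ∈ (0, κ(r)) where κ(r) = γ(1−α)/(γ(1+α) + 2(1−γ)r) and r = ‖x*‖₂,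
  a feasible point x* is the unique minimizer of the constrained DCEN problem. -/
theorem stmt9 {m n : ℕ} (α γ : ℝ) (hα : 0 < α) (hα1 : α < 1)
    (hγ : 0 < γ) (hγ1 : γ < 1)
    (A : Matrix (Fin m) (Fin n) ℝ) (b : Fin m → ℝ)
    (xstar : Fin n → ℝ) (hfeas : A.mulVec xstar = b)
    (r : ℝ) (hr : r = norm2 xstar)
    (Λ : Finset (Fin n)) (hΛ : Λ = Finset.univ.filter (fun i => xstar i ≠ 0))
    (κ : ℝ) (hκ0 : 0 < κ)
    (hκ : κ < γ * (1 - α) / (γ * (1 + α) + 2 * (1 - γ) * r))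
    (hNSP : ∀ h : Fin n → ℝ, h ≠ 0 → A.mulVec h = 0 →
      norm1 (fun i => if i ∈ Λ then h i else 0)
        < κ * norm1 (fun i => if i ∉ Λ then h i else 0)) :
    ∀ x : Fin n → ℝ, A.mulVec x = b → fag α γ x ≤ fag α γ xstar → x = xstar := by
  intro x hx hle
  by_contra hne
  obtain ⟨h, rfl⟩ : ∃ h, x = xstar + h := ⟨x - xstar, by simp⟩
  have hh : h ≠ 0 := fun h0 => hne (by simp [h0])
  have hker : A.mulVec h = 0 := by
    rw [Matrix.mulVec_add, hfeas] at hx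
    simpa using hx
  have hsupp : ∀ i, i ∉ Λ → xstar i = 0 := fun i hi => by simpa [hΛ] using hi
  have hnsp := hNSP h hh hker
  have hsum := norm1_restrict_add_compl Λ h
  have hl1 := norm1_add_ge Λ xstar h hsupp
  have hip := abs_le.mp (abs_sum_mul_le_norm2_mul_norm1_restrict Λ xstar h hsupp)
  have hsq := norm2_add_sq xstar h
  have hh2 := sum_sq_le_norm1_sq h
  have hh2_nonneg : 0 ≤ ∑ i, h i ^ 2 := Finset.sum_nonneg fun _ _ => sq_nonneg _
  have hS := norm1_nonneg (fun i => if i ∈ Λ then h i else 0)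
  have hT := norm1_nonneg (fun i => if i ∉ Λ then h i else 0)
  have hr0 := norm2_nonneg xstar
  unfold fag at hle
  rw [← hr] at *
  set S := norm1 (fun i => if i ∈ Λ then h i else 0)
  set T := norm1 (fun i => if i ∉ Λ then h i else 0)
  rw [← hsum] at hh2
  have htri : norm2 (xstar + h) ≤ r + (S + T) := by
    refine abs_le_of_sq_le_sq' ?_ (by positivity) |>.2
    nlinarith [mul_nonneg hr0 hT]
  have hlow : r ^ 2 - 2 * (r * S) ≤ norm2 (xstar + h) ^ 2 := by linarith [hip.1]
  have hD : 0 < γ * (1 + α) + 2 * (1 - γ) * r := by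
    have : 0 ≤ (1 - γ) * r := mul_nonneg (by linarith) hr0
    have : 0 < γ * (1 + α) := by positivity
    linarith
  rw [lt_div_iff₀ hD] at hκ
  have h1 := mul_lt_mul_of_pos_right hnsp hD
  have h2 := mul_le_mul_of_nonneg_right hκ.le hT
  have h3 := mul_le_mul_of_nonneg_left hl1 hγ.le
  have h4 := mul_le_mul_of_nonneg_left htri (mul_pos hγ hα).le
  have h5 := mul_le_mul_of_nonneg_left hlow (sub_pos.mpr hγ1).le
  linarith
end

section
/- Let λ > 0, γ ∈ (0,1), α ≥ 0, and y ∈ ℝ^n. Set λ̃ = λγ/(1 + 2λ(1−γ)) and ỹ = y/(1 + 2λ(1−γ)). Then the set of global minimizers of x ↦ γ(‖x‖₁ − α‖x‖₂) + (1−γ)‖x‖₂² + (1/(2λ))‖x − y‖₂² coincides with the set of global minimizers of x ↦ ‖x‖₁ − α‖x‖₂ + (1/(2λ̃))‖x − ỹ‖₂². -/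
/-- Completing the square in a sum of two quadratic penalties. -/
theorem mul_norm2_sq_add_mul_norm2_sub_sq {n : ℕ} {a b : ℝ} (hab : a + b ≠ 0)
    (x y : Fin n → ℝ) :
    a * norm2 x ^ 2 + b * norm2 (x - y) ^ 2
      = (a + b) * norm2 (x - (b / (a + b)) • y) ^ 2 + a * b / (a + b) * norm2 y ^ 2 := by
  simp only [norm2_sq, Finset.mul_sum, ← Finset.sum_add_distrib]
  refine Finset.sum_congr rfl fun i _ => ?_
  simp only [Pi.sub_apply, Pi.smul_apply, smul_eq_mul]
  field_simp
  ring

/-- For λ > 0, γ ∈ (0,1), α ≥ 0, y ∈ ℝ^n, with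
  λ̃ = λγ/(1 + 2λ(1−γ)) and ỹ = y/(1 + 2λ(1−γ)), the set of global minimizers of
  x ↦ γ(‖x‖₁ − α‖x‖₂) + (1−γ)‖x‖₂² + (1/(2λ))‖x − y‖₂² coincides with the set of global
  minimizers of x ↦ ‖x‖₁ − α‖x‖₂ + (1/(2λ̃))‖x − ỹ‖₂². -/
theorem stmt12 {n : ℕ} (lam γ α : ℝ) (hlam : 0 < lam)
    (hγ : 0 < γ) (hγ1 : γ < 1) (hα : 0 ≤ α)
    (y : Fin n → ℝ)
    (lamT : ℝ) (hlamT : lamT = lam * γ / (1 + 2 * lam * (1 - γ)))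
    (yT : Fin n → ℝ) (hyT : yT = (1 / (1 + 2 * lam * (1 - γ))) • y) :
    {x : Fin n → ℝ | ∀ z : Fin n → ℝ,
        γ * (norm1 x - α * norm2 x) + (1 - γ) * (norm2 x) ^ 2
            + (1 / (2 * lam)) * (norm2 (x - y)) ^ 2
          ≤ γ * (norm1 z - α * norm2 z) + (1 - γ) * (norm2 z) ^ 2
            + (1 / (2 * lam)) * (norm2 (z - y)) ^ 2}
      = {x : Fin n → ℝ | ∀ z : Fin n → ℝ,
        norm1 x - α * norm2 x + (1 / (2 * lamT)) * (norm2 (x - yT)) ^ 2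
          ≤ norm1 z - α * norm2 z + (1 / (2 * lamT)) * (norm2 (z - yT)) ^ 2} := by
  have hD : 0 < 1 + 2 * lam * (1 - γ) := by
    have := mul_pos hlam (sub_pos.2 hγ1)
    linarith
  have hsum : (1 - γ) + 1 / (2 * lam) = (1 + 2 * lam * (1 - γ)) / (2 * lam) := by
    field_simp
    ring
  have hsum_pos : 0 < (1 - γ) + 1 / (2 * lam) := hsum ▸ by positivity
  have hcenter : (1 / (2 * lam) / ((1 - γ) + 1 / (2 * lam))) • y = yT := by
    rw [hyT, hsum]
    congr 1
    field_simp
  have hcoeff : (1 - γ) + 1 / (2 * lam) = γ * (1 / (2 * lamT)) := by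
    rw [hsum, hlamT]
    field_simp
  have key : ∀ x : Fin n → ℝ,
      γ * (norm1 x - α * norm2 x) + (1 - γ) * norm2 x ^ 2 + 1 / (2 * lam) * norm2 (x - y) ^ 2
        = γ * (norm1 x - α * norm2 x + 1 / (2 * lamT) * norm2 (x - yT) ^ 2)
          + (1 - γ) * (1 / (2 * lam)) / ((1 - γ) + 1 / (2 * lam)) * norm2 y ^ 2 := by
    intro x
    have h := mul_norm2_sq_add_mul_norm2_sub_sq hsum_pos.ne' x y
    rw [hcenter] at h
    rw [add_assoc, h]
    nth_rewrite 1 [hcoeff]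
    ring
  ext x
  simp only [Set.mem_ofPred_eq, key, add_le_add_iff_right, mul_le_mul_iff_right₀ hγ]
end

section
/- Let λ > 0, γ ∈ (0,1), α ≥ 0, and y ∈ ℝ^n with ‖y‖∞ > γλ. Define the soft-thresholding operator S_{γλ}(y) componentwise by (S_{γλ}(y))_i = sign(y_i)·max(|y_i| − γλ, 0). Then every global minimizer x* of the proximal objective f_{γ,α}(x) = γ(‖x‖₁ − α‖x‖₂) + (1−γ)‖x‖₂² + (1/(2λ))‖x − y‖₂² is given by x* = ((‖S_{γλ}(y)‖₂ + αγλ) / ((1 + 2λ(1−γ))·‖S_{γλ}(y)‖₂))·S_{γλ}(y). -/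
/-- The DCEN proximal objective
  f_{γ,α}(x) = γ(‖x‖₁ − α‖x‖₂) + (1−γ)‖x‖₂² + (1/(2λ))‖x − y‖₂². -/
noncomputable def proxObj {n : ℕ} (lam γ α : ℝ) (y x : Fin n → ℝ) : ℝ :=
  γ * (norm1 x - α * norm2 x) + (1 - γ) * (norm2 x) ^ 2
    + (1 / (2 * lam)) * (norm2 (x - y)) ^ 2

theorem norm2_smul_of_nonneg {n : ℕ} {k : ℝ} (hk : 0 ≤ k) (x : Fin n → ℝ) :
    norm2 (k • x) = k * norm2 x := by
  simp only [norm2, Pi.smul_apply, smul_eq_mul, mul_pow, ← Finset.mul_sum]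
  rw [Real.sqrt_mul (sq_nonneg k), Real.sqrt_sq hk]

theorem norm2_sub_sq {n : ℕ} (x y : Fin n → ℝ) :
    norm2 (x - y) ^ 2 = norm2 x ^ 2 - 2 * ∑ i, x i * y i + norm2 y ^ 2 := by
  simp only [norm2_sq, Pi.sub_apply, Finset.mul_sum]
  rw [← Finset.sum_sub_distrib, ← Finset.sum_add_distrib]
  exact Finset.sum_congr rfl fun i _ => by ring

/-- The proximal objective, rescaled by `lam` and with the quadratic term expanded. -/
theorem mul_proxObj {n : ℕ} {lam : ℝ} (hlam : lam ≠ 0) (γ α : ℝ) (y x : Fin n → ℝ) :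
    lam * proxObj lam γ α y x =
      -(∑ i, (x i * y i - γ * lam * |x i|)) - α * γ * lam * norm2 x
        + (1 + 2 * lam * (1 - γ)) / 2 * norm2 x ^ 2 + norm2 y ^ 2 / 2 := by
  rw [proxObj, norm2_sub_sq, norm1, Finset.sum_sub_distrib, ← Finset.mul_sum]
  field_simp
  ring

theorem mul_sub_mul_abs_le_mul_softThreshold {t : ℝ} (ht : 0 ≤ t) (x y : ℝ) :
    x * y - t * |x| ≤ x * (Real.sign y * max (|y| - t) 0) := by
  have hxy : x * y ≤ |x| * |y| := (le_abs_self _).trans_eq (abs_mul x y)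
  rcases le_or_gt |y| t with h | h
  · rw [max_eq_right (by linarith)]
    nlinarith [abs_nonneg x]
  · rw [max_eq_left (by linarith)]
    rcases lt_trichotomy y 0 with hy | rfl | hy
    · rw [Real.sign_of_neg hy, abs_of_neg hy]
      nlinarith [neg_abs_le x]
    · simp only [abs_zero] at h
      linarith
    · rw [Real.sign_of_pos hy, abs_of_pos hy]
      nlinarith [le_abs_self x]

theorem softThreshold_mul_sub_mul_abs {t : ℝ} (ht : 0 ≤ t) (y : ℝ) :
    (Real.sign y * max (|y| - t) 0) * y - t * |Real.sign y * max (|y| - t) 0| =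
      (Real.sign y * max (|y| - t) 0) ^ 2 := by
  rcases le_or_gt |y| t with h | h
  · simp [max_eq_right (sub_nonpos.2 h)]
  · rw [max_eq_left (by linarith)]
    rcases lt_trichotomy y 0 with hy | rfl | hy
    · rw [abs_of_neg hy] at h
      rw [Real.sign_of_neg hy, abs_of_neg hy, abs_of_nonpos (by linarith)]; ring
    · simp at h; linarith
    · rw [abs_of_pos hy] at h
      rw [Real.sign_of_pos hy, abs_of_pos hy, abs_of_nonneg (by linarith)]; ring

/-- If ‖y‖∞ > γλ, then every global minimizer of the DCEN proximal
  objective equals ((‖S_{γλ}(y)‖₂ + αγλ)/((1 + 2λ(1−γ))‖S_{γλ}(y)‖₂))·S_{γλ}(y),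
  where S_{γλ} is componentwise soft-thresholding. -/
theorem stmt13 {n : ℕ} (lam γ α : ℝ) (hlam : 0 < lam)
    (hγ : 0 < γ) (hγ1 : γ < 1) (hα : 0 ≤ α)
    (y : Fin n → ℝ) (hy : ∃ i, γ * lam < |y i|)
    (S : Fin n → ℝ) (hS : S = fun i => Real.sign (y i) * max (|y i| - γ * lam) 0)
    (xstar : Fin n → ℝ)
    (hmin : ∀ x : Fin n → ℝ, proxObj lam γ α y xstar ≤ proxObj lam γ α y x) :
    xstar = ((norm2 S + α * γ * lam) / ((1 + 2 * lam * (1 - γ)) * norm2 S)) • S := by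
  set t := γ * lam with ht
  have ht0 : 0 < t := mul_pos hγ hlam
  have hc : 0 < 1 + 2 * lam * (1 - γ) := by nlinarith
  have hs : 0 < norm2 S := by
    obtain ⟨i, hi⟩ := hy
    refine Real.sqrt_pos.2 (Finset.sum_pos' (fun _ _ => sq_nonneg _) ⟨i, Finset.mem_univ i, ?_⟩)
    have hyi : y i ≠ 0 := abs_pos.1 (ht0.trans hi)
    have hm : max (|y i| - t) 0 ≠ 0 := (lt_max_of_lt_left (sub_pos.2 hi)).ne'
    have hSi : S i ≠ 0 := by
      rw [hS]
      exact mul_ne_zero (mt Real.sign_eq_zero_iff.1 hyi) hm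
    positivity
  have upper : ∑ i, (xstar i * y i - t * |xstar i|) ≤ ∑ i, xstar i * S i :=
    Finset.sum_le_sum fun i _ => by
      rw [hS]
      exact mul_sub_mul_abs_le_mul_softThreshold ht0.le _ _
  have cauchy : ∑ i, xstar i * S i ≤ norm2 xstar * norm2 S :=
    Real.sum_mul_le_sqrt_mul_sqrt _ _ _
  set k := (norm2 S + α * γ * lam) / ((1 + 2 * lam * (1 - γ)) * norm2 S) with hk
  have hk0 : 0 ≤ k := by positivity
  have hkc : (1 + 2 * lam * (1 - γ)) * (k * norm2 S) = norm2 S + α * γ * lam := by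
    rw [hk]; field_simp
  have value : ∑ i, ((k • S) i * y i - t * |(k • S) i|) = k * norm2 S ^ 2 := by
    rw [norm2_sq, Finset.mul_sum]
    refine Finset.sum_congr rfl fun i _ => ?_
    have h := softThreshold_mul_sub_mul_abs ht0.le (y i)
    simp only [Pi.smul_apply, smul_eq_mul, abs_mul, abs_of_nonneg hk0]
    rw [hS]
    simp only [abs_mul] at h ⊢
    linear_combination k * h
  have hle := mul_le_mul_of_nonneg_left (hmin (k • S)) hlam.le
  rw [mul_proxObj hlam.ne', mul_proxObj hlam.ne', ← ht, value, norm2_smul_of_nonneg hk0] at hle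
  generalize 1 + 2 * lam * (1 - γ) = c at *
  have gap : c / 2 * (norm2 xstar - k * norm2 S) ^ 2
      + (norm2 xstar * norm2 S - ∑ i, xstar i * S i) ≤ 0 := by
    linear_combination hle + upper + (k * norm2 S - norm2 xstar) * hkc
  have hr : norm2 xstar = k * norm2 S := by
    have : (norm2 xstar - k * norm2 S) ^ 2 ≤ 0 := by nlinarith
    nlinarith [pow_eq_zero_iff two_ne_zero |>.1 (le_antisymm this (sq_nonneg _))]
  have hin : norm2 xstar * norm2 S ≤ ∑ i, xstar i * S i := by
    nlinarith [sq_nonneg (norm2 xstar - k * norm2 S)]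
  have hd : norm2 (xstar - k • S) ^ 2 ≤ 0 := by
    have hsum : ∑ i, xstar i * (k • S) i = k * ∑ i, xstar i * S i := by
      rw [Finset.mul_sum]
      exact Finset.sum_congr rfl fun i _ => by simp only [Pi.smul_apply, smul_eq_mul]; ring
    rw [norm2_sub_sq, hsum, norm2_smul_of_nonneg hk0]
    rw [hr] at hin ⊢
    nlinarith [mul_le_mul_of_nonneg_left hin hk0]
  rw [norm2_sq] at hd
  funext i
  have hi := (Finset.single_le_sum (fun j _ => sq_nonneg ((xstar - k • S) j))
    (Finset.mem_univ i)).trans hd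
  exact sub_eq_zero.1 (pow_eq_zero_iff two_ne_zero |>.1 (le_antisymm hi (sq_nonneg _)))
end

section
/- Let A ∈ ℝ^{m×n}, b ∈ ℝ^m, λ > 0, γ ∈ (0,1), and α ∈ (0,1). Then the set of global minimizers of the DCEN objective H(x) = (1/2)‖Ax − b‖₂² + λ(γ(‖x‖₁ − α‖x‖₂) + (1−γ)‖x‖₂²) over ℝ^n is nonempty and compact. -/
/-- The DCEN objective
  H(x) = (1/2)‖Ax − b‖₂² + λ(γ(‖x‖₁ − α‖x‖₂) + (1−γ)‖x‖₂²). -/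
noncomputable def dcenObj {m n : ℕ} (A : Matrix (Fin m) (Fin n) ℝ) (b : Fin m → ℝ)
    (lam γ α : ℝ) (x : Fin n → ℝ) : ℝ :=
  (1 / 2) * (norm2 (A.mulVec x - b)) ^ 2
    + lam * (γ * (norm1 x - α * norm2 x) + (1 - γ) * (norm2 x) ^ 2)

theorem continuous_norm1 {n : ℕ} : Continuous (norm1 : (Fin n → ℝ) → ℝ) := by
  unfold norm1
  fun_prop

theorem continuous_norm2 {n : ℕ} : Continuous (norm2 : (Fin n → ℝ) → ℝ) := by
  unfold norm2
  fun_prop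

theorem norm_le_norm1 {n : ℕ} (x : Fin n → ℝ) : ‖x‖ ≤ norm1 x :=
  (pi_norm_le_iff_of_nonneg (norm1_nonneg x)).2 fun i =>
    Finset.single_le_sum (f := fun i => |x i|) (fun j _ => abs_nonneg (x j)) (Finset.mem_univ i)

theorem continuous_dcenObj {m n : ℕ} (A : Matrix (Fin m) (Fin n) ℝ) (b : Fin m → ℝ)
    (lam γ α : ℝ) : Continuous (dcenObj A b lam γ α) := by
  have h1 := continuous_norm1 (n := n)
  have h2 := continuous_norm2 (n := n)
  have h3 : Continuous fun x : Fin n → ℝ => norm2 (A.mulVec x - b) :=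
    continuous_norm2.comp ((continuous_const.matrix_mulVec continuous_id).sub continuous_const)
  unfold dcenObj
  fun_prop

theorem mul_norm_le_dcenObj {m n : ℕ} (A : Matrix (Fin m) (Fin n) ℝ) (b : Fin m → ℝ)
    {lam γ α : ℝ} (hlam : 0 ≤ lam) (hγ : 0 ≤ γ) (hγ1 : γ ≤ 1) (hα : 0 ≤ α) (hα1 : α ≤ 1)
    (x : Fin n → ℝ) : lam * γ * (1 - α) * ‖x‖ ≤ dcenObj A b lam γ α x := by
  have hα1' : 0 ≤ 1 - α := sub_nonneg.2 hα1
  have hγ1' : 0 ≤ 1 - γ := sub_nonneg.2 hγ1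
  calc lam * γ * (1 - α) * ‖x‖
      ≤ lam * γ * (1 - α) * norm1 x := by gcongr; exact norm_le_norm1 x
    _ = 0 + lam * (γ * (norm1 x - α * norm1 x) + 0) := by ring
    _ ≤ dcenObj A b lam γ α x := by
      unfold dcenObj
      gcongr
      · positivity
      · exact norm2_le_norm1 x
      · positivity

theorem tendsto_dcenObj_cocompact {m n : ℕ} (A : Matrix (Fin m) (Fin n) ℝ) (b : Fin m → ℝ)
    {lam γ α : ℝ} (hlam : 0 < lam) (hγ : 0 < γ) (hγ1 : γ ≤ 1) (hα : 0 ≤ α) (hα1 : α < 1) :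
    Filter.Tendsto (dcenObj A b lam γ α) (Filter.cocompact (Fin n → ℝ)) Filter.atTop :=
  Filter.tendsto_atTop_mono (mul_norm_le_dcenObj A b hlam.le hγ.le hγ1 hα hα1.le)
    ((tendsto_norm_cocompact_atTop (E := Fin n → ℝ)).const_mul_atTop
      (mul_pos (mul_pos hlam hγ) (sub_pos.2 hα1)))

/-- A continuous function tending to infinity along the cocompact filter has a nonempty compact
set of global minimizers. -/
theorem Continuous.nonempty_and_isCompact_setOf_forall_le {X : Type*} [TopologicalSpace X]
    [Nonempty X] {f : X → ℝ} (hf : Continuous f)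
    (hlim : Filter.Tendsto f (Filter.cocompact X) Filter.atTop) :
    {x | ∀ z, f x ≤ f z}.Nonempty ∧ IsCompact {x | ∀ z, f x ≤ f z} := by
  obtain ⟨x₀, hx₀⟩ := hf.exists_forall_le hlim
  refine ⟨⟨x₀, hx₀⟩, ?_⟩
  obtain ⟨K, hK, hKf⟩ := Filter.mem_cocompact.1 (hlim.eventually_gt_atTop (f x₀))
  have hclosed : IsClosed {x | ∀ z, f x ≤ f z} := by
    simp only [Set.ofPred_forall]
    exact isClosed_iInter fun z => isClosed_le hf continuous_const
  refine hK.of_isClosed_subset hclosed fun x hx => ?_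
  by_contra hxK
  exact absurd (hx x₀) (not_le.2 (hKf hxK))

/-- For λ > 0, γ ∈ (0,1), α ∈ (0,1), the set of global minimizers of the
  DCEN objective is nonempty and compact. -/
theorem stmt16 {m n : ℕ} (A : Matrix (Fin m) (Fin n) ℝ) (b : Fin m → ℝ)
    (lam γ α : ℝ) (hlam : 0 < lam)
    (hγ : 0 < γ) (hγ1 : γ < 1) (hα : 0 < α) (hα1 : α < 1) :
    ({x : Fin n → ℝ | ∀ z : Fin n → ℝ,
        dcenObj A b lam γ α x ≤ dcenObj A b lam γ α z}).Nonempty ∧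
    IsCompact {x : Fin n → ℝ | ∀ z : Fin n → ℝ,
        dcenObj A b lam γ α x ≤ dcenObj A b lam γ α z} :=
  (continuous_dcenObj A b lam γ α).nonempty_and_isCompact_setOf_forall_le
    (tendsto_dcenObj_cocompact A b hlam hγ hγ1.le hα.le hα1)
end
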